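/- Let D₂ = {(x,y) ∈ ℝ² : x·y = 0} and let K = {(3,1), (1,−3), (−3,−1), (−1,3), (2,2)} ⊆ ℝ². Then conv_{D₂} K = ([−1,1] × [−1,2]) ∪ ([1,2] × [1,2]) ∪ ({1} × [−3,2]) ∪ ({−1} × [−1,3]) ∪ ([−3,1] × {−1}) ∪ ([−1,3] × {1}) ∪ ([−1,2] × {2}). -/

import Mathlib

/-- A function `f` is `D`-convex if it is convex along every direction in the cone `D`. -/
def DConvex {E : Type*} [AddCommGroup E] [Module ℝ E] (D : Set E) (f : E → ℝ) : Prop :=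
  ∀ A : E, ∀ B ∈ D, ConvexOn ℝ Set.univ (fun t : ℝ => f (A + t • B))

/-- The `D`-convex hull of a set `K`. -/
def DConvexHull {E : Type*} [AddCommGroup E] [Module ℝ E] (D : Set E) (K : Set E) : Set E :=
  {A | ∀ f : E → ℝ, DConvex D f → f A ≤ sSup (f '' K)}

/-- The cone of rank-one directions for diagonal `2×2` matrices, identified with `ℝ²`. -/
def D2 : Set (ℝ × ℝ) := {v | v.1 * v.2 = 0}

theorem sep_prod (g h : ℝ → ℝ) (hg : ConvexOn ℝ Set.univ g) (hh : ConvexOn ℝ Set.univ h)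
    (g0 : ∀ x, 0 ≤ g x) (h0 : ∀ x, 0 ≤ h x) :
    DConvex D2 (fun p : ℝ × ℝ => g p.1 * h p.2) := by
  rintro ⟨a1, a2⟩ ⟨b1, b2⟩ hB
  refine ⟨convex_univ, fun s _ t _ a b ha hb hab => ?_⟩
  simp only [D2, Set.mem_ofPred_eq, mul_eq_zero] at hB
  simp only [Prod.smul_mk, Prod.mk_add_mk, smul_eq_mul]
  rcases hB with hB | hB
  · subst hB
    have := hh.2 (Set.mem_univ (a2 + s * b2)) (Set.mem_univ (a2 + t * b2)) ha hb hab
    have e : a • (a2 + s * b2) + b • (a2 + t * b2) = a2 + (a * s + b * t) * b2 := by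
      simp only [smul_eq_mul]
      linear_combination a2 * hab
    rw [e] at this
    simp only [smul_eq_mul] at this
    simp only [mul_zero, add_zero]
    have := mul_le_mul_of_nonneg_left this (g0 a1)
    linarith
  · subst hB
    have := hg.2 (Set.mem_univ (a1 + s * b1)) (Set.mem_univ (a1 + t * b1)) ha hb hab
    have e : a • (a1 + s * b1) + b • (a1 + t * b1) = a1 + (a * s + b * t) * b1 := by
      simp only [smul_eq_mul]
      linear_combination a1 * hab
    rw [e] at this
    simp only [smul_eq_mul] at this
    simp only [mul_zero, add_zero]
    have := mul_le_mul_of_nonneg_right this (h0 a2)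
    linarith

theorem conv_pos_part (s c : ℝ) : ConvexOn ℝ Set.univ (fun x : ℝ => max (s * x + c) 0) := by
  refine ⟨convex_univ, fun x _ y _ a b ha hb hab => ?_⟩
  simp only [smul_eq_mul]
  apply max_le
  · have h1 := mul_le_mul_of_nonneg_left (le_max_left (s * x + c) 0) ha
    have h2 := mul_le_mul_of_nonneg_left (le_max_left (s * y + c) 0) hb
    have : s * (a * x + b * y) + c = a * (s * x + c) + b * (s * y + c) := by
      linear_combination (-c) * hab
    linarith
  · positivity

abbrev K5 : Set (ℝ × ℝ) := {((3 : ℝ), (1 : ℝ)), (1, -3), (-3, -1), (-1, 3), (2, 2)}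

/-- Separation by a product of two positive parts of affine functions. -/
theorem sep_excl {x y : ℝ} (hA : (x, y) ∈ DConvexHull D2 K5) (s c t d : ℝ)
    (hK : ∀ p ∈ K5, s * p.1 + c ≤ 0 ∨ t * p.2 + d ≤ 0) : s * x + c ≤ 0 ∨ t * y + d ≤ 0 := by
  by_contra! hcon
  have := hA _ (sep_prod _ _ (conv_pos_part s c) (conv_pos_part t d)
    (fun _ => le_max_right _ _) (fun _ => le_max_right _ _))
  have h2 : sSup ((fun p : ℝ × ℝ => max (s * p.1 + c) 0 * max (t * p.2 + d) 0) '' K5) ≤ 0 := by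
    apply csSup_le
    · exact ⟨_, Set.mem_image_of_mem _ (Set.mem_insert _ _)⟩
    · rintro _ ⟨p, hp, rfl⟩
      rcases hK p hp with h | h
      · simp [max_eq_right h]
      · simp [max_eq_right h]
  simp only [max_eq_left hcon.1.le, max_eq_left hcon.2.le] at this
  have := mul_pos hcon.1 hcon.2
  linarith

theorem conv_h {f : ℝ × ℝ → ℝ} (hf : DConvex D2 f) (y : ℝ) :
    ConvexOn ℝ Set.univ (fun x => f (x, y)) := by
  have := hf (0, y) (1, 0) (by simp [D2])
  simpa using this

theorem conv_v {f : ℝ × ℝ → ℝ} (hf : DConvex D2 f) (x : ℝ) :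
    ConvexOn ℝ Set.univ (fun y => f (x, y)) := by
  have := hf (x, 0) (0, 1) (by simp [D2])
  simpa using this

theorem conv_mid {g : ℝ → ℝ} (hg : ConvexOn ℝ Set.univ g) (a b c : ℝ) (h : c = (a + b) / 2) :
    g c ≤ (g a + g b) / 2 := by
  have := hg.2 (Set.mem_univ a) (Set.mem_univ b) (by norm_num : (0 : ℝ) ≤ 1 / 2)
    (by norm_num : (0 : ℝ) ≤ 1 / 2) (by norm_num)
  have e : (1 / 2 : ℝ) • a + (1 / 2 : ℝ) • b = c := by simp only [smul_eq_mul]; linarith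
  rw [e] at this
  simp only [smul_eq_mul] at this
  linarith

theorem conv_between {g : ℝ → ℝ} (hg : ConvexOn ℝ Set.univ g) {a b M : ℝ} (ha : g a ≤ M)
    (hb : g b ≤ M) (c : ℝ) (h1 : a ≤ c) (h2 : c ≤ b) : g c ≤ M :=
  (hg.le_max_of_mem_Icc (Set.mem_univ a) (Set.mem_univ b) ⟨h1, h2⟩).trans (max_le ha hb)

/-- The separately convex hull of the five planar points
`{(3,1), (1,−3), (−3,−1), (−1,3), (2,2)}` is the explicit union of two boxes and five
axis-parallel segments. -/
theorem five_point_planar_hull :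
    DConvexHull D2 {((3 : ℝ), (1 : ℝ)), (1, -3), (-3, -1), (-1, 3), (2, 2)} =
      (Set.Icc (-1 : ℝ) 1 ×ˢ Set.Icc (-1 : ℝ) 2) ∪
      (Set.Icc (1 : ℝ) 2 ×ˢ Set.Icc (1 : ℝ) 2) ∪
      (({1} : Set ℝ) ×ˢ Set.Icc (-3 : ℝ) 2) ∪
      (({-1} : Set ℝ) ×ˢ Set.Icc (-1 : ℝ) 3) ∪
      (Set.Icc (-3 : ℝ) 1 ×ˢ ({-1} : Set ℝ)) ∪
      (Set.Icc (-1 : ℝ) 3 ×ˢ ({1} : Set ℝ)) ∪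
      (Set.Icc (-1 : ℝ) 2 ×ˢ ({2} : Set ℝ)) := by
  apply Set.Subset.antisymm
  · rintro ⟨x, y⟩ hA
    change (x, y) ∈ DConvexHull D2 K5 at hA
    have e1 := sep_excl hA 1 (-1) (-1) 1 (by simp [K5]; try norm_num)
    have e2 := sep_excl hA (-1) 1 (-1) (-1) (by simp [K5]; try norm_num)
    have e3 := sep_excl hA (-1) (-1) 1 1 (by simp [K5]; try norm_num)
    have e4 := sep_excl hA 1 1 1 (-2) (by simp [K5]; try norm_num)
    have e5 := sep_excl hA 1 (-2) 1 (-1) (by simp [K5]; try norm_num)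
    have e6 := sep_excl hA 1 (-3) 0 1 (by simp [K5]; try norm_num)
    have e7 := sep_excl hA (-1) (-3) 0 1 (by simp [K5]; try norm_num)
    have e8 := sep_excl hA 0 1 1 (-3) (by simp [K5]; try norm_num)
    have e9 := sep_excl hA 0 1 (-1) (-3) (by simp [K5]; try norm_num)
    simp only [Set.mem_union, Set.mem_prod, Set.mem_Icc, Set.mem_singleton_iff]
    grind
  · rintro ⟨x, y⟩ hA f hf
    have key : ∀ p ∈ K5, f p ≤ sSup (f '' K5) := fun p hp =>
      le_csSup ((Set.toFinite K5).image f).bddAbove (Set.mem_image_of_mem f hp)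
    change f (x, y) ≤ sSup (f '' K5)
    generalize sSup (f '' K5) = M at key
    have k1 : f (3, 1) ≤ M := key _ (by simp [K5])
    have k2 : f (1, -3) ≤ M := key _ (by simp [K5])
    have k3 : f (-3, -1) ≤ M := key _ (by simp [K5])
    have k4 : f (-1, 3) ≤ M := key _ (by simp [K5])
    have k5 : f (2, 2) ≤ M := key _ (by simp [K5])
    have m1 := conv_mid (conv_h hf 1) (-1) 3 1 (by norm_num)
    have m2 := conv_mid (conv_v hf (-1)) (-1) 3 1 (by norm_num)
    have m3 := conv_mid (conv_h hf (-1)) (-3) 1 (-1) (by norm_num)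
    have m4 := conv_mid (conv_v hf 1) (-3) 1 (-1) (by norm_num)
    have c1 : f (-1, 1) ≤ M := by linarith
    have c2 : f (-1, -1) ≤ M := by linarith
    have c3 : f (1, -1) ≤ M := by linarith
    have s1 := conv_between (conv_h hf 1) c1 k1
    have s2 := conv_between (conv_v hf (-1)) c2 k4
    have s3 := conv_between (conv_h hf (-1)) k3 c3
    have s4 := conv_between (conv_h hf 2) (s2 2 (by norm_num) (by norm_num)) k5
    have s5 := conv_between (conv_v hf 1) k2 (s4 1 (by norm_num) (by norm_num))
    have b1 : ∀ x y : ℝ, -1 ≤ x → x ≤ 1 → -1 ≤ y → y ≤ 2 → f (x, y) ≤ M := by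
      intro x y h1 h2 h3 h4
      exact conv_between (conv_h hf y) (s2 y h3 (by linarith)) (s5 y (by linarith) h4) x h1 h2
    have b2 : ∀ x y : ℝ, 1 ≤ x → x ≤ 2 → 1 ≤ y → y ≤ 2 → f (x, y) ≤ M := by
      intro x y h1 h2 h3 h4
      exact conv_between (conv_v hf x) (s1 x (by linarith) (by linarith))
        (s4 x (by linarith) h2) y h3 h4
    simp only [Set.mem_union, Set.mem_prod, Set.mem_Icc, Set.mem_singleton_iff] at hA
    rcases hA with (((((h | h) | h) | h) | h) | h) | h
    · exact b1 x y h.1.1 h.1.2 h.2.1 h.2.2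
    · exact b2 x y h.1.1 h.1.2 h.2.1 h.2.2
    · rw [h.1]; exact s5 y h.2.1 h.2.2
    · rw [h.1]; exact s2 y h.2.1 h.2.2
    · rw [h.2]; exact s3 x h.1.1 h.1.2
    · rw [h.2]; exact s1 x h.1.1 h.1.2
    · rw [h.2]; exact s4 x h.1.1 h.1.2
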